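/- arXiv:0911.1475 — 2 statements merged into one kernel-verified Lean document; each statement's English description precedes it below -/
import Mathlib

section
/- Let p be a prime, q = p², and let N be a divisor of q−1 that does not divide p−1. Then the matrix M has rank q−1 over ℚ. -/
/-- The matrix of the linear system attached to a splitting perfect polynomial:
`M γ δ = -N` if `δ = γ + 1`, `M γ δ = 1` if `δ = γ` or (`δ ≠ γ` and `(γ+1-δ)^N = 1`),
and `M γ δ = 0` otherwise. -/
def Mmat (N : ℕ) (F : Type*) [Field F] [DecidableEq F] : Matrix F F ℚ :=
  Matrix.of fun γ δ =>
    if δ = γ + 1 then -(N : ℚ)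
    else if δ = γ ∨ (δ ≠ γ ∧ (γ + 1 - δ) ^ N = 1) then 1 else 0

theorem pow_natCard_eq_self {R : Type*} [CommRing R] [IsDomain R] [Finite R] (a : R) :
    a ^ Nat.card R = a := by
  classical
  have := Fintype.ofFinite R
  let : Field R := Fintype.fieldOfDomain R
  rw [Nat.card_eq_fintype_card]
  exact FiniteField.pow_card a

theorem exists_isPrimitiveRoot_of_dvd_card_sub_one {F : Type*} [Field F] [Fintype F] {N : ℕ}
    (hN : N ∣ Fintype.card F - 1) : ∃ ζ : F, IsPrimitiveRoot ζ N := by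
  classical
  obtain ⟨g, hg⟩ := IsCyclic.exists_generator (α := Fˣ)
  have ho : orderOf g = Fintype.card F - 1 := by
    rw [orderOf_eq_card_of_forall_mem_zpowers hg, Nat.card_eq_fintype_card, Fintype.card_units]
  have hpos : 0 < Fintype.card F - 1 := by have := Fintype.one_lt_card (α := F); omega
  obtain ⟨k, hk⟩ := hN
  have h : IsPrimitiveRoot g (Fintype.card F - 1) := ho ▸ IsPrimitiveRoot.orderOf g
  exact ⟨_, IsPrimitiveRoot.coe_units_iff.mpr (h.pow hpos (hk.trans (mul_comm _ _)))⟩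

/-- In the field with `p ^ 2` elements, the only subring containing an element whose `p - 1`-st
power is not `1` is the whole field. -/
theorem Subring.eq_top_of_pow_ne_one {F : Type*} [Field F] [Fintype F] {p : ℕ} (hp : p.Prime)
    (hcard : Fintype.card F = p ^ 2) (R : Subring F) {ζ : F} (hζ : ζ ∈ R) (h0 : ζ ≠ 0)
    (h1 : ζ ^ (p - 1) ≠ 1) : R = ⊤ := by
  have hdvd : Nat.card R ∣ p ^ 2 := by
    rw [← hcard, ← Nat.card_eq_fintype_card]
    exact AddSubgroup.card_addSubgroup_dvd_card R.toAddSubgroup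
  obtain ⟨k, hk, hR⟩ := (Nat.dvd_prime_pow hp).mp hdvd
  have hone : 1 < Nat.card R := Finite.one_lt_card
  interval_cases k
  · simp at hR
    omega
  · have h := congrArg Subtype.val (pow_natCard_eq_self (⟨ζ, hζ⟩ : R))
    rw [hR, pow_one] at h
    simp only [SubmonoidClass.mk_pow] at h
    refine absurd (mul_right_cancel₀ h0 ?_) h1
    rw [pow_sub_one_mul hp.ne_zero, h, one_mul]
  · have : R.toAddSubgroup = ⊤ := by
      apply AddSubgroup.eq_top_of_card_eq
      rw [Nat.card_eq_fintype_card (α := F), hcard]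
      exact hR
    ext x
    simpa using (SetLike.ext_iff.mp this x)

/-- A set in a finite additive group stable under subtracting the elements of `s` is stable under
subtracting the elements of the subgroup generated by `s`. -/
theorem sub_mem_of_mem_addSubgroupClosure {A : Type*} [AddCommGroup A] [Finite A] {s T : Set A}
    (h : ∀ x ∈ T, ∀ a ∈ s, x - a ∈ T) {a : A} (ha : a ∈ AddSubgroup.closure s) :
    ∀ x ∈ T, x - a ∈ T := by
  induction ha using AddSubgroup.closure_induction with
  | mem a ha => exact fun x hx => h x hx a ha
  | zero => simp
  | add a b _ _ iha ihb =>
    intro x hx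
    rw [← sub_sub]
    exact ihb _ (iha _ hx)
  | neg a _ ih =>
    have key : ∀ n : ℕ, ∀ x ∈ T, x - n • a ∈ T := by
      intro n
      induction n with
      | zero => simp
      | succ n ihn =>
        intro x hx
        rw [succ_nsmul, ← sub_sub]
        exact ih _ (ihn _ hx)
    intro x hx
    have hpos := addOrderOf_pos a
    have hn : (addOrderOf a - 1) • a = -a := by
      rw [eq_neg_iff_add_eq_zero, ← succ_nsmul, Nat.sub_add_cancel hpos, addOrderOf_nsmul_eq_zero]
    exact hn ▸ key _ x hx

/-- The maximum principle: a function on a finite additive group whose value at each point is the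
average of its values over the translates by a generating set is constant. -/
theorem eq_of_card_mul_eq_sum_sub {A : Type*} [AddCommGroup A] [Finite A] (s : Finset A)
    (hs : AddSubgroup.closure (s : Set A) = ⊤) {v : A → ℚ}
    (hv : ∀ x, (s.card : ℚ) * v x = ∑ a ∈ s, v (x - a)) (x y : A) : v x = v y := by
  obtain ⟨m, hm⟩ := Finite.exists_max v
  suffices h : ∀ x, v x = v m by rw [h x, h y]
  intro x
  have step : ∀ z ∈ {z | v z = v m}, ∀ a ∈ (s : Set A), z - a ∈ {z | v z = v m} := by
    intro z hz a ha
    have hz : v z = v m := hz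
    have h0 : ∑ b ∈ s, (v m - v (z - b)) = 0 := by
      rw [Finset.sum_sub_distrib, ← hv z, hz, Finset.sum_const, nsmul_eq_mul, sub_self]
    have := (Finset.sum_eq_zero_iff_of_nonneg fun b _ => sub_nonneg.mpr (hm (z - b))).mp h0 a ha
    exact (sub_eq_zero.mp this).symm
  have := sub_mem_of_mem_addSubgroupClosure step (a := m - x) (hs ▸ AddSubgroup.mem_top _) m rfl
  rwa [sub_sub_cancel] at this

theorem Mmat_mulVec {F : Type*} [Field F] [Fintype F] [DecidableEq F] {N : ℕ} (hN : 0 < N)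
    (v : F → ℚ) (γ : F) :
    (Mmat N F).mulVec v γ =
      ∑ ζ ∈ Polynomial.nthRootsFinset N (1 : F), v (γ + 1 - ζ) - N * v (γ + 1) := by
  have hentry : ∀ δ, Mmat N F γ δ * v δ =
      (if (γ + 1 - δ) ^ N = 1 then v δ else 0) - (if δ = γ + 1 then N * v δ else 0) := by
    intro δ
    simp only [Mmat, Matrix.of_apply]
    by_cases h1 : δ = γ + 1
    · simp [h1, hN.ne']
    · by_cases h2 : δ = γ
      · simp [h2]
      · simp [h1, h2]
  have hroots : Polynomial.nthRootsFinset N (1 : F) = Finset.univ.filter fun ζ => ζ ^ N = 1 := by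
    ext ζ
    simp [Polynomial.mem_nthRootsFinset hN]
  rw [Matrix.mulVec, dotProduct, Finset.sum_congr rfl fun δ _ => hentry δ, Finset.sum_sub_distrib,
    Finset.sum_ite_eq', if_pos (Finset.mem_univ _), hroots, Finset.sum_filter]
  congr 1
  exact Fintype.sum_equiv (Equiv.subLeft (γ + 1)) _ _ fun δ => by simp

theorem stmt11 (p : ℕ) (hp : p.Prime) (F : Type*) [Field F] [Fintype F] [DecidableEq F]
    (hcard : Fintype.card F = p ^ 2)
    (N : ℕ) (hNq : N ∣ p ^ 2 - 1) (hNp : ¬ N ∣ p - 1) :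
    (Mmat N F).rank = p ^ 2 - 1 := by
  have hN : 0 < N := by
    refine Nat.pos_of_dvd_of_pos hNq ?_
    have := Fintype.one_lt_card (α := F)
    omega
  obtain ⟨ζ, hζ⟩ := exists_isPrimitiveRoot_of_dvd_card_sub_one (F := F) (hcard ▸ hNq)
  set s := Polynomial.nthRootsFinset N (1 : F) with hs
  have hmem : ∀ x, x ∈ s ↔ x ^ N = 1 := fun x => Polynomial.mem_nthRootsFinset hN 1
  have hscard : s.card = N := hζ.card_nthRootsFinset
  have hsub : (Submonoid.closure (s : Set F) : Set F) = s := by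
    refine Set.Subset.antisymm (fun x hx => ?_) Submonoid.subset_closure
    induction hx using Submonoid.closure_induction with
    | mem x hx => exact hx
    | one => simp [hmem]
    | mul x y _ _ hx hy =>
      simp only [Finset.mem_coe, hmem] at hx hy ⊢
      rw [mul_pow, hx, hy, one_mul]
  have hring : Subring.closure (s : Set F) = ⊤ :=
    Subring.eq_top_of_pow_ne_one hp hcard _
      (Subring.subset_closure (Finset.mem_coe.mpr ((hmem ζ).mpr hζ.pow_eq_one)))
      (hζ.ne_zero hN.ne') fun h => hNp (hζ.dvd_of_pow_eq_one _ h)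
  have hgen : AddSubgroup.closure (s : Set F) = ⊤ := by
    refine (AddSubgroup.eq_top_iff' _).mpr fun x => ?_
    have hx : x ∈ Subring.closure (s : Set F) := hring ▸ Subring.mem_top x
    rwa [Subring.mem_closure_iff, hsub] at hx
  have hker : LinearMap.ker (Mmat N F).mulVecLin = Submodule.span ℚ {(1 : F → ℚ)} := by
    ext v
    rw [LinearMap.mem_ker, Submodule.mem_span_singleton]
    constructor
    · intro hv
      refine ⟨v 0, funext fun x => ?_⟩
      have hharm : ∀ x, (s.card : ℚ) * v x = ∑ a ∈ s, v (x - a) := by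
        intro x
        have h := Mmat_mulVec hN v (x - 1)
        rw [← Matrix.mulVecLin_apply, hv, sub_add_cancel] at h
        rw [hscard]
        exact (sub_eq_zero.mp h.symm).symm
      simpa using eq_of_card_mul_eq_sum_sub s hgen hharm 0 x
    · rintro ⟨c, rfl⟩
      ext γ
      rw [Matrix.mulVecLin_apply, Mmat_mulVec hN]
      simp [← hs, hscard]
  have hrank := LinearMap.finrank_range_add_finrank_ker (Mmat N F).mulVecLin
  rw [hker, finrank_span_singleton one_ne_zero, Module.finrank_fintype_fun_eq_card, hcard] at hrank
  exact Nat.eq_sub_of_add_eq hrank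
end

section
/- Let p be a prime, q = p², let N ≥ 1 be a divisor of p−1, let n ∈ ℕ, and let a ∈ F_q. Then the polynomial B = ∏_{c ∈ F_p} (x − a − c)^{N·p^n − 1} ∈ F_q[x] is perfect. -/
open Polynomial

/-- The sum of all monic divisors of a polynomial. -/
noncomputable def polySigma {F : Type*} [Field F] (A : F[X]) : F[X] :=
  ∑ᶠ d ∈ {d : F[X] | d.Monic ∧ d ∣ A}, d

/-- A polynomial is perfect if it equals the sum of its monic divisors. -/
def IsPerfectPoly {F : Type*} [Field F] (A : F[X]) : Prop := polySigma A = A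

/-- The exponents of a product of powers of distinct linear factors are its root multiplicities. -/
lemma count_roots_prod_X_sub_C_pow {F ι : Type*} [Field F] [DecidableEq F] [Fintype ι]
    {r : ι → F} (hr : Function.Injective r) (e : ι → ℕ) (i : ι) :
    (∏ j, (X - C (r j)) ^ e j).roots.count (r i) = e i := by
  classical
  have h0 : (∏ j, (X - C (r j)) ^ e j) ≠ 0 :=
    Finset.prod_ne_zero_iff.2 fun j _ => pow_ne_zero _ (X_sub_C_ne_zero _)
  rw [roots_prod _ _ h0]
  simp only [roots_pow, roots_X_sub_C, Multiset.bind, Multiset.join]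
  change Multiset.count (r i) (∑ j, e j • {r j}) = e i
  simp [Multiset.count_sum', Multiset.count_nsmul, Multiset.count_singleton, hr.eq_iff]

lemma mem_range_of_mem_roots_prod_X_sub_C_pow {F ι : Type*} [Field F] [Fintype ι]
    {r : ι → F} {e : ι → ℕ} {x : F} (hx : x ∈ (∏ j, (X - C (r j)) ^ e j).roots) :
    ∃ i, r i = x := by
  have h := (mem_roots'.1 hx).2
  rw [IsRoot, eval_prod, Finset.prod_eq_zero_iff] at h
  obtain ⟨i, -, hi⟩ := h
  refine ⟨i, ?_⟩
  have := eq_zero_of_pow_eq_zero (by simpa using hi : (x - r i) ^ e i = 0)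
  exact (sub_eq_zero.1 this).symm

/-- The monic divisors of a product of powers of distinct linear factors are the obvious ones. -/
lemma bijOn_monic_divisors {F ι : Type*} [Field F] [Fintype ι] [DecidableEq ι]
    {r : ι → F} (hr : Function.Injective r) (e : ι → ℕ) :
    Set.BijOn (fun g : ι → ℕ => ∏ i, (X - C (r i)) ^ g i)
      (Fintype.piFinset fun i => Finset.range (e i + 1) : Finset (ι → ℕ))
      {d : F[X] | d.Monic ∧ d ∣ ∏ i, (X - C (r i)) ^ e i} := by
  classical
  have h0 : (∏ j, (X - C (r j)) ^ e j) ≠ 0 :=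
    Finset.prod_ne_zero_iff.2 fun j _ => pow_ne_zero _ (X_sub_C_ne_zero _)
  refine ⟨fun g hg => ⟨monic_prod_of_monic _ _ fun i _ => (monic_X_sub_C _).pow _,
    Finset.prod_dvd_prod_of_dvd _ _ fun i _ => pow_dvd_pow _ ?_⟩, fun g _ g' _ h => ?_, ?_⟩
  · have := Fintype.mem_piFinset.1 (Finset.mem_coe.1 hg) i
    simpa [Nat.lt_succ_iff] using this
  · funext i
    rw [← count_roots_prod_X_sub_C_pow hr g i, ← count_roots_prod_X_sub_C_pow hr g' i]
    exact congrArg (fun q : F[X] => q.roots.count (r i)) h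
  · rintro d ⟨hd, hdvd⟩
    have hle := Polynomial.roots.le_of_dvd h0 hdvd
    refine ⟨fun i => d.roots.count (r i), ?_, ?_⟩
    · refine Finset.mem_coe.2 (Fintype.mem_piFinset.2 fun i => Finset.mem_range_succ_iff.2 ?_)
      exact (Multiset.count_le_of_le _ hle).trans (count_roots_prod_X_sub_C_pow hr e i).le
    · have hs : (∏ j, (X - C (r j)) ^ e j).Splits :=
        Splits.prod fun j _ => (Splits.X_sub_C _).pow _
      have hds := hs.of_dvd h0 hdvd
      beta_reduce
      conv_rhs => rw [hds.eq_prod_roots_of_monic hd, Finset.prod_multiset_map_count]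
      rw [← Finset.prod_image (s := Finset.univ) (g := r)
        (f := fun x => (X - C x) ^ d.roots.count x) hr.injOn]
      refine (Finset.prod_subset (fun x hx => ?_) fun x _ hx => ?_).symm
      · obtain ⟨i, rfl⟩ := mem_range_of_mem_roots_prod_X_sub_C_pow
          (Multiset.mem_of_le hle (Multiset.mem_toFinset.1 hx))
        exact Finset.mem_image_of_mem _ (Finset.mem_univ _)
      · rw [Multiset.count_eq_zero.2 (by simpa using hx), pow_zero]

lemma polySigma_prod_X_sub_C_pow {F ι : Type*} [Field F] [Fintype ι]
    {r : ι → F} (hr : Function.Injective r) (e : ι → ℕ) :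
    polySigma (∏ i, (X - C (r i)) ^ e i) =
      ∏ i, ∑ j ∈ Finset.range (e i + 1), (X - C (r i)) ^ j := by
  classical
  rw [Finset.prod_univ_sum, ← finsum_mem_coe_finset, polySigma]
  exact (finsum_mem_eq_of_bijOn _ (bijOn_monic_divisors hr e) fun _ _ => rfl).symm

/-- `X ^ N - 1` splits into distinct linear factors over `ZMod p` when `N ∣ p - 1`. -/
lemma exists_finset_prod_eq_X_pow_sub_one {p N : ℕ} [Fact p.Prime] (hN : 1 ≤ N)
    (hNp : N ∣ p - 1) :
    ∃ s : Finset (ZMod p), s.card = N ∧ (X ^ N - 1 : (ZMod p)[X]) = ∏ z ∈ s, (X - C z) := by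
  obtain ⟨g, hg⟩ := IsCyclic.exists_generator (α := (ZMod p)ˣ)
  have hord : orderOf g = p - 1 := by
    rw [orderOf_eq_card_of_forall_mem_zpowers hg, Nat.card_eq_fintype_card, ZMod.card_units]
  obtain ⟨k, hk⟩ := hNp
  have hp1 : 0 < p - 1 := Nat.sub_pos_of_lt (Fact.out : p.Prime).one_lt
  have hprim : IsPrimitiveRoot (g : ZMod p) (p - 1) := by
    rw [IsPrimitiveRoot.coe_units_iff, ← hord]
    exact IsPrimitiveRoot.orderOf g
  have h := hprim.pow hp1 (hk.trans (mul_comm _ _))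
  exact ⟨nthRootsFinset N 1, h.card_nthRootsFinset, X_pow_sub_one_eq_prod hN h⟩

theorem stmt16 (p : ℕ) (hp : p.Prime) [NeZero p] (F : Type*) [Field F] [Fintype F]
    [CharP F p] (hcard : Fintype.card F = p ^ 2)
    (N : ℕ) (hN1 : 1 ≤ N) (hNp : N ∣ p - 1) (n : ℕ) (a : F) :
    IsPerfectPoly (∏ c : ZMod p,
      (X - C a - C (ZMod.castHom (dvd_refl p) F c)) ^ (N * p ^ n - 1)) := by
  have : Fact p.Prime := ⟨hp⟩
  set φ : ZMod p →+* F := ZMod.castHom (dvd_refl p) F with hφ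
  have hm : N * p ^ n - 1 + 1 = N * p ^ n :=
    Nat.sub_add_cancel (Nat.mul_pos hN1 (pow_pos hp.pos n))
  have hr : Function.Injective fun c : ZMod p => a + φ c :=
    (add_right_injective a).comp φ.injective
  have hL (c : ZMod p) : X - C a - C (φ c) = X - C (a + φ c) := by rw [C_add, sub_sub]
  simp only [IsPerfectPoly, hL]
  rw [polySigma_prod_X_sub_C_pow hr fun _ => N * p ^ n - 1, hm]
  obtain ⟨s, hs, hX⟩ := exists_finset_prod_eq_X_pow_sub_one hN1 hNp
  have hshift (z : ZMod p) :
      ∏ c : ZMod p, (X - C (a + φ c) - C (φ z)) = ∏ c : ZMod p, (X - C (a + φ c)) := by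
    refine Fintype.prod_equiv (Equiv.addRight z) _ _ fun c => ?_
    simp [sub_sub, add_assoc]
  have hfac (L : F[X]) : L ^ (N * p ^ n) - 1 = ∏ z ∈ s, (L - C (φ z)) ^ p ^ n := by
    have h := congrArg (eval₂ (C.comp φ) L) hX
    simp only [eval₂_sub, eval₂_X_pow, eval₂_one, eval₂_finsetProd, eval₂_X, eval₂_C,
      RingHom.comp_apply] at h
    rw [Finset.prod_pow, ← h, sub_pow_char_pow, one_pow, pow_mul]
  have h0 : (∏ c : ZMod p, (X - C (a + φ c))) ≠ 0 :=
    Finset.prod_ne_zero_iff.2 fun c _ => X_sub_C_ne_zero _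
  refine mul_right_cancel₀ h0 ?_
  conv_lhs => rw [← hshift 1]
  rw [← Finset.prod_mul_distrib, ← Finset.prod_mul_distrib]
  simp only [map_one, geom_sum_mul, hfac, ← pow_succ, hm]
  rw [Finset.prod_comm]
  simp only [Finset.prod_pow, hshift, Finset.prod_const, hs]
  rw [← pow_mul, mul_comm]
end
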